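/- arXiv:2009.06323 — 6 statements merged into one kernel-verified Lean document; each statement's English description precedes it below -/
import Mathlib

section
/- Let H be a complex Hilbert space and let a be a bounded linear operator on H with ‖a‖ ≤ 1 such that 1 − a is injective. Then for every x ∈ H, (1 − p)·(1 − p·a)^{-1}x converges in norm to 0 as p ↑ 1. -/
open Filter Topology

/-- The range of `1 - a` is dense when `a` is a contraction and `1 - a` is injective. -/
theorem dense_range_one_sub_of_contraction {H : Type*} [NormedAddCommGroup H]
    [InnerProductSpace ℂ H] [CompleteSpace H] (a : H →L[ℂ] H) (ha : ‖a‖ ≤ 1)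
    (hinj : Function.Injective fun x : H => ((1 : H →L[ℂ] H) - a) x) :
    Dense (((1 : H →L[ℂ] H) - a).range : Set H) := by
  rw [Submodule.dense_iff_topologicalClosure_eq_top, Submodule.topologicalClosure_eq_top_iff,
    Submodule.eq_bot_iff]
  intro y hy
  have horth : inner ℂ (y - a y) y = 0 := hy (y - a y) ⟨y, by simp⟩
  have hle : ‖a y‖ ≤ ‖y‖ := by simpa using a.le_of_opNorm_le ha y
  have hsq : ‖(y - a y) - y‖ ^ 2 = ‖y - a y‖ ^ 2 + ‖y‖ ^ 2 := by
    rw [@norm_sub_sq ℂ, horth]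
    simp
  have hay : ‖(y - a y) - y‖ = ‖a y‖ := by simp
  have hzero : ‖y - a y‖ = 0 := by
    rw [hay] at hsq
    nlinarith [norm_nonneg (a y), norm_nonneg (y - a y)]
  apply hinj
  simpa using hzero

/-- For a contraction `a` and `0 ≤ p < 1`, the operator `1 - p a` is invertible. -/
theorem isUnit_one_sub_smul_of_contraction {H : Type*} [NormedAddCommGroup H]
    [NormedSpace ℂ H] [CompleteSpace H] (a : H →L[ℂ] H) (ha : ‖a‖ ≤ 1) {p : ℝ}
    (hp : p ∈ Set.Ico (0 : ℝ) 1) : IsUnit ((1 : H →L[ℂ] H) - (p : ℂ) • a) := by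
  apply isUnit_one_sub_of_norm_lt_one
  rw [norm_smul, Complex.norm_real, Real.norm_of_nonneg hp.1]
  nlinarith [hp.1, hp.2]

/-- The resolvent bound `(1 - p) ‖(1 - p a)⁻¹ x‖ ≤ ‖x‖` for a contraction `a`. -/
theorem norm_smul_inverse_one_sub_smul_le {H : Type*} [NormedAddCommGroup H]
    [NormedSpace ℂ H] [CompleteSpace H] (a : H →L[ℂ] H) (ha : ‖a‖ ≤ 1) {p : ℝ}
    (hp : p ∈ Set.Ico (0 : ℝ) 1) (x : H) :
    ‖((1 - p : ℝ) : ℂ) • Ring.inverse ((1 : H →L[ℂ] H) - (p : ℂ) • a) x‖ ≤ ‖x‖ := by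
  set z := Ring.inverse ((1 : H →L[ℂ] H) - (p : ℂ) • a) x with hz
  have hx : z - (p : ℂ) • a z = x := by
    simpa [hz] using DFunLike.congr_fun (Ring.mul_inverse_cancel _
      (isUnit_one_sub_smul_of_contraction a ha hp)) x
  have haz : ‖a z‖ ≤ ‖z‖ := by simpa using a.le_of_opNorm_le ha z
  have hsub := norm_sub_norm_le z ((p : ℂ) • a z)
  rw [hx, norm_smul, Complex.norm_real, Real.norm_of_nonneg hp.1] at hsub
  rw [norm_smul, Complex.norm_real, Real.norm_of_nonneg (sub_nonneg.2 hp.2.le)]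
  nlinarith [mul_le_mul_of_nonneg_left haz hp.1]

/-- On the range of `1 - a` the scaled resolvent of a contraction is `O(1 - p)`. -/
theorem norm_smul_inverse_one_sub_smul_apply_sub_le {H : Type*} [NormedAddCommGroup H]
    [NormedSpace ℂ H] [CompleteSpace H] (a : H →L[ℂ] H) (ha : ‖a‖ ≤ 1) {p : ℝ}
    (hp : p ∈ Set.Ico (0 : ℝ) 1) (w : H) :
    ‖((1 - p : ℝ) : ℂ) • Ring.inverse ((1 : H →L[ℂ] H) - (p : ℂ) • a) (w - a w)‖ ≤
      (1 - p) * (2 * ‖w‖) := by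
  have hdecomp : w - a w =
      ((1 : H →L[ℂ] H) - (p : ℂ) • a) w - ((1 - p : ℝ) : ℂ) • a w := by
    simp [sub_smul]
  have hinv : Ring.inverse ((1 : H →L[ℂ] H) - (p : ℂ) • a)
      (((1 : H →L[ℂ] H) - (p : ℂ) • a) w) = w :=
    DFunLike.congr_fun (Ring.inverse_mul_cancel _
      (isUnit_one_sub_smul_of_contraction a ha hp)) w
  rw [hdecomp, map_sub, hinv, map_smul, norm_smul, Complex.norm_real,
    Real.norm_of_nonneg (sub_nonneg.2 hp.2.le)]
  refine mul_le_mul_of_nonneg_left ?_ (sub_nonneg.2 hp.2.le)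
  have haw : ‖a w‖ ≤ ‖w‖ := by simpa using a.le_of_opNorm_le ha w
  linarith [norm_sub_le w (((1 - p : ℝ) : ℂ) •
    Ring.inverse ((1 : H →L[ℂ] H) - (p : ℂ) • a) (a w)),
    norm_smul_inverse_one_sub_smul_le a ha hp (a w)]

/-- If `a` is a contraction on a complex Hilbert space and `1 - a` is injective, then
`(1 - p)·(1 - p·a)⁻¹ x → 0` in norm as `p ↑ 1`, for every `x`. -/
theorem stmt_1 {H : Type*} [NormedAddCommGroup H] [InnerProductSpace ℂ H] [CompleteSpace H]
    (a : H →L[ℂ] H) (ha : ‖a‖ ≤ 1)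
    (hinj : Function.Injective fun x : H => ((1 : H →L[ℂ] H) - a) x) :
    ∀ x : H,
      Filter.Tendsto
        (fun p : ℝ => ((1 - p : ℝ) : ℂ) • (Ring.inverse ((1 : H →L[ℂ] H) - (p : ℂ) • a)) x)
        (nhdsWithin 1 (Set.Ico (0 : ℝ) 1)) (nhds 0) := by
  intro x
  rw [Metric.tendsto_nhds]
  intro ε hε
  obtain ⟨_, hw, w, rfl⟩ := Metric.dense_iff.1
    (dense_range_one_sub_of_contraction a ha hinj) x (ε / 2) (half_pos hε)
  have hlim : Tendsto (fun p : ℝ => (1 - p) * (2 * ‖w‖)) (𝓝[Set.Ico (0 : ℝ) 1] 1) (𝓝 0) := by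
    have hcont : Continuous fun p : ℝ => (1 - p) * (2 * ‖w‖) := by fun_prop
    simpa using (hcont.tendsto 1).mono_left nhdsWithin_le_nhds
  filter_upwards [hlim.eventually_lt_const (half_pos hε), self_mem_nhdsWithin] with p hsmall hp
  have hdist : ‖x - (w - a w)‖ < ε / 2 := by
    simpa [dist_eq_norm, norm_sub_rev] using hw
  have hrange := norm_smul_inverse_one_sub_smul_apply_sub_le a ha hp w
  have hrest := norm_smul_inverse_one_sub_smul_le a ha hp (x - (w - a w))
  rw [dist_zero_right]
  nth_rewrite 1 [← sub_add_cancel x (w - a w)]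
  rw [map_add, smul_add]
  refine (norm_add_le _ _).trans_lt ?_
  linarith
end

section
/- Let π be a unital $*$-homomorphism from A into the bounded operators B(H) on a complex Hilbert space H such that 1 − π(u_{NN}) is injective, let η: A → H be a π-ε-cocycle, and assume the elements u_{jk} generate A as a unital algebra. For 0 < p < 1 put f_p := −(1 − p·π(u_{NN}))^{-1} η(u_{NN}). Then for every a ∈ A, π(a − ε(a)·1) f_p converges in norm to η(a) as p ↑ 1; in other words, η is the pointwise limit of the coboundaries b ↦ π(b − ε(b)·1) f_p. -/
open Filter Topology

section Resolvent

variable {H : Type*} [NormedAddCommGroup H] [InnerProductSpace ℂ H]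

/-- The resolvent-type operator `(1 - p T)⁻¹`, with value `0` when `1 - p T` is not invertible. -/
noncomputable def invOneSub (T : H →L[ℂ] H) (p : ℝ) : H →L[ℂ] H :=
  Ring.inverse (1 - (p : ℂ) • T)

variable [CompleteSpace H] {T : H →L[ℂ] H}

lemma isUnit_one_sub_smul (hT : ‖T‖ ≤ 1) {p : ℝ} (hp : p ∈ Set.Ioo (0 : ℝ) 1) :
    IsUnit (1 - (p : ℂ) • T) := by
  apply isUnit_one_sub_of_norm_lt_one
  rw [norm_smul, Complex.norm_real, Real.norm_of_nonneg hp.1.le]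
  nlinarith [hp.1, hp.2, norm_nonneg T]

lemma invOneSub_apply_sub (hT : ‖T‖ ≤ 1) {p : ℝ} (hp : p ∈ Set.Ioo (0 : ℝ) 1) (x : H) :
    invOneSub T p (x - (p : ℂ) • T x) = x := by
  simpa [invOneSub] using
    DFunLike.congr_fun (Ring.inverse_mul_cancel _ (isUnit_one_sub_smul hT hp)) x

lemma invOneSub_sub_apply (hT : ‖T‖ ≤ 1) {p : ℝ} (hp : p ∈ Set.Ioo (0 : ℝ) 1) (x : H) :
    invOneSub T p x - (p : ℂ) • T (invOneSub T p x) = x := by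
  simpa [invOneSub] using
    DFunLike.congr_fun (Ring.mul_inverse_cancel _ (isUnit_one_sub_smul hT hp)) x

lemma invOneSub_sub_apply_self (hT : ‖T‖ ≤ 1) {p : ℝ} (hp : p ∈ Set.Ioo (0 : ℝ) 1) (y : H) :
    invOneSub T p (y - T y) = y - (1 - p : ℂ) • invOneSub T p (T y) := by
  have h := invOneSub_apply_sub hT hp y
  rw [map_sub, map_smul] at h
  rw [map_sub]
  linear_combination (norm := module) h

lemma norm_one_sub_smul_invOneSub_le (hT : ‖T‖ ≤ 1) {p : ℝ} (hp : p ∈ Set.Ioo (0 : ℝ) 1)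
    (x : H) : ‖(1 - p : ℂ) • invOneSub T p x‖ ≤ ‖x‖ := by
  set y := invOneSub T p x
  have hy : y - (p : ℂ) • T y = x := invOneSub_sub_apply hT hp x
  have hpT : ‖(p : ℂ) • T y‖ ≤ p * ‖y‖ := by
    rw [norm_smul, Complex.norm_real, Real.norm_of_nonneg hp.1.le]
    gcongr
    · exact hp.1.le
    · exact T.le_of_opNorm_le_of_le hT le_rfl |>.trans_eq (one_mul _)
  have hn : ‖(1 - p : ℂ)‖ = 1 - p := by
    rw [← Complex.ofReal_one, ← Complex.ofReal_sub, Complex.norm_real,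
      Real.norm_of_nonneg (by linarith [hp.2])]
  rw [norm_smul, hn, ← hy]
  linarith [norm_sub_norm_le y ((p : ℂ) • T y)]

/-- A contraction fixes every fixed vector of its adjoint. -/
lemma eq_self_of_adjoint_eq_self (hT : ‖T‖ ≤ 1) {x : H}
    (hx : ContinuousLinearMap.adjoint T x = x) : T x = x := by
  have hTx : ‖T x‖ ≤ ‖x‖ := (T.le_of_opNorm_le hT x).trans_eq (one_mul _)
  have hin : inner ℂ (T x) x = inner ℂ x x := by
    rw [← ContinuousLinearMap.adjoint_inner_right, hx]
  have hsq : ‖T x - x‖ ^ 2 ≤ 0 := by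
    rw [@norm_sub_sq ℂ, hin, inner_self_eq_norm_sq]
    nlinarith [norm_nonneg (T x)]
  exact sub_eq_zero.mp (norm_eq_zero.mp (by nlinarith [norm_nonneg (T x - x)]))

lemma denseRange_one_sub (hT : ‖T‖ ≤ 1)
    (hinj : Function.Injective fun x : H => ((1 : H →L[ℂ] H) - T) x) :
    DenseRange ((1 : H →L[ℂ] H) - T) := by
  have h : (LinearMap.range ((1 : H →L[ℂ] H) - T).toLinearMap).topologicalClosure = ⊤ := by
    rw [Submodule.topologicalClosure_eq_top_iff, ContinuousLinearMap.orthogonal_range,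
      Submodule.eq_bot_iff]
    intro x hx
    have hx' : ContinuousLinearMap.adjoint T x = x := by
      have h₀ : x - ContinuousLinearMap.adjoint T x = 0 := by
        simpa [← ContinuousLinearMap.star_eq_adjoint] using LinearMap.mem_ker.mp hx
      exact (sub_eq_zero.mp h₀).symm
    exact hinj (by simp [eq_self_of_adjoint_eq_self hT hx'])
  exact Submodule.dense_iff_topologicalClosure_eq_top.mpr h

lemma tendsto_one_sub_smul {E : Type*} [NormedAddCommGroup E] [NormedSpace ℂ E] {f : ℝ → E}
    {y : E} (hf : Tendsto f (𝓝[Set.Ioo (0 : ℝ) 1] 1) (𝓝 y)) :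
    Tendsto (fun p : ℝ => (1 - p : ℂ) • f p) (𝓝[Set.Ioo (0 : ℝ) 1] 1) (𝓝 0) := by
  have h : Tendsto (fun p : ℝ => (1 - p : ℂ)) (𝓝[Set.Ioo (0 : ℝ) 1] 1) (𝓝 0) := by
    have : Continuous fun p : ℝ => (1 - p : ℂ) := by fun_prop
    simpa using (this.tendsto 1).mono_left nhdsWithin_le_nhds
  simpa using h.smul hf

/-- The Abel version of the mean ergodic theorem for a contraction without fixed vectors. -/
lemma tendsto_one_sub_smul_invOneSub (hT : ‖T‖ ≤ 1)
    (hinj : Function.Injective fun x : H => ((1 : H →L[ℂ] H) - T) x)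
    {f : ℝ → H} {x : H} (hf : Tendsto f (𝓝[Set.Ioo (0 : ℝ) 1] 1) (𝓝 x)) :
    Tendsto (fun p : ℝ => (1 - p : ℂ) • invOneSub T p (f p)) (𝓝[Set.Ioo (0 : ℝ) 1] 1)
      (𝓝 0) := by
  rw [Metric.tendsto_nhds]
  intro δ hδ
  obtain ⟨y, hy⟩ := (denseRange_one_sub hT hinj).exists_dist_lt x (by positivity : 0 < δ / 3)
  have h₀ := (tendsto_one_sub_smul (tendsto_const_nhds (x := (2 * ‖y‖ : ℂ)))).norm
  rw [norm_zero] at h₀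
  have h₁ : Tendsto (fun p : ℝ => ‖(1 - p : ℂ)‖ * (2 * ‖y‖)) (𝓝[Set.Ioo (0 : ℝ) 1] 1)
      (𝓝 0) := by
    simpa [norm_smul] using h₀
  filter_upwards [self_mem_nhdsWithin, Metric.tendsto_nhds.mp hf (δ / 3) (by positivity),
    h₁.eventually_lt_const (by positivity : 0 < δ / 3)] with p hp hfp hyp
  have hyp' : ‖(1 - p : ℂ) • invOneSub T p (y - T y)‖ ≤ ‖(1 - p : ℂ)‖ * (2 * ‖y‖) := by
    rw [norm_smul, invOneSub_sub_apply_self hT hp]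
    gcongr
    have hTy : ‖T y‖ ≤ ‖y‖ := (T.le_of_opNorm_le hT y).trans_eq (one_mul _)
    linarith [norm_sub_le y ((1 - p : ℂ) • invOneSub T p (T y)),
      norm_one_sub_smul_invOneSub_le hT hp (T y)]
  have hsplit : (1 - p : ℂ) • invOneSub T p (f p) = (1 - p : ℂ) • invOneSub T p (f p - x) +
      (1 - p : ℂ) • invOneSub T p (x - (y - T y)) +
      (1 - p : ℂ) • invOneSub T p (y - T y) := by
    simp only [← smul_add, ← map_add]
    congr 2
    abel
  have hxy : ‖x - (y - T y)‖ < δ / 3 := by simpa [dist_eq_norm] using hy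
  rw [dist_eq_norm] at hfp
  rw [dist_zero_right, hsplit]
  refine norm_add₃_le.trans_lt ?_
  linarith [norm_one_sub_smul_invOneSub_le hT hp (f p - x),
    norm_one_sub_smul_invOneSub_le hT hp (x - (y - T y))]

lemma tendsto_invOneSub_sub (hT : ‖T‖ ≤ 1)
    (hinj : Function.Injective fun x : H => ((1 : H →L[ℂ] H) - T) x) (y : H) :
    Tendsto (fun p : ℝ => invOneSub T p (y - T y)) (𝓝[Set.Ioo (0 : ℝ) 1] 1) (𝓝 y) := by
  have h := (tendsto_const_nhds (x := y)).sub
    (tendsto_one_sub_smul_invOneSub hT hinj (tendsto_const_nhds (x := T y)))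
  rw [sub_zero] at h
  refine h.congr' ?_
  filter_upwards [self_mem_nhdsWithin] with p hp
  exact (invOneSub_sub_apply_self hT hp y).symm

lemma mul_mem_Ioo_zero_one {p q : ℝ} (hp : p ∈ Set.Ioo (0 : ℝ) 1) (hq : q ∈ Set.Ioo (0 : ℝ) 1) :
    p * q ∈ Set.Ioo (0 : ℝ) 1 :=
  ⟨mul_pos hp.1 hq.1, by nlinarith [hp.1, hp.2, hq.1, hq.2]⟩

lemma tendsto_invOneSub_mul (hT : ‖T‖ ≤ 1) {q : ℝ} (hq : q ∈ Set.Ioo (0 : ℝ) 1) (y : H) :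
    Tendsto (fun p : ℝ => invOneSub T (p * q) y) (𝓝[Set.Ioo (0 : ℝ) 1] 1)
      (𝓝 (invOneSub T q y)) := by
  obtain ⟨v, hv⟩ := isUnit_one_sub_smul hT hq
  have hc : Continuous fun p : ℝ => (1 : H →L[ℂ] H) - ((p * q : ℝ) : ℂ) • T := by fun_prop
  have h₁ := hc.tendsto 1
  rw [one_mul, ← hv] at h₁
  have h₂ := (NormedRing.inverse_continuousAt v).tendsto.comp h₁
  rw [hv] at h₂
  exact ((ContinuousLinearMap.apply ℂ H y).continuous.tendsto _).comp
    (h₂.mono_left nhdsWithin_le_nhds)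

/-- The defect of the approximation for an operator `b` that `q`-commutes with `T`. -/
lemma sub_smul_apply_invOneSub (hT : ‖T‖ ≤ 1) {q p : ℝ} (hq : q ∈ Set.Ioo (0 : ℝ) 1)
    (hp : p ∈ Set.Ioo (0 : ℝ) 1) {b : H →L[ℂ] H} (hb : ∀ x, b (T x) = (q : ℂ) • T (b x))
    {h y : H} (hy : b h + y = (q : ℂ) • T y) :
    y - (p : ℂ) • b (-invOneSub T p h) = (1 - p : ℂ) • invOneSub T (p * q) y := by
  have hpq := mul_mem_Ioo_zero_one hp hq
  rw [← invOneSub_apply_sub hT hpq (y - (p : ℂ) • b (-invOneSub T p h)),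
    ← map_smul (invOneSub T (p * q))]
  congr 1
  have hbh : b h = (q : ℂ) • T y - y := eq_sub_of_add_eq hy
  have hf : b (invOneSub T p h) - ((p : ℂ) * q) • T (b (invOneSub T p h)) =
      (q : ℂ) • T y - y := by
    rw [← hbh, mul_smul, ← hb, ← map_smul b, ← map_sub, invOneSub_sub_apply hT hp]
  simp only [map_neg, map_smul, Complex.ofReal_mul, smul_neg, sub_neg_eq_add, map_add]
  linear_combination (norm := module) (p : ℂ) • hf

lemma tendsto_apply_invOneSub (hT : ‖T‖ ≤ 1) {q : ℝ} (hq : q ∈ Set.Ioo (0 : ℝ) 1)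
    {b : H →L[ℂ] H} (hb : ∀ x, b (T x) = (q : ℂ) • T (b x))
    {h y : H} (hy : b h + y = (q : ℂ) • T y) :
    Tendsto (fun p : ℝ => b (-invOneSub T p h)) (𝓝[Set.Ioo (0 : ℝ) 1] 1) (𝓝 y) := by
  have h₁ := (tendsto_const_nhds (x := y)).sub
    (tendsto_one_sub_smul (tendsto_invOneSub_mul hT hq y))
  have hc : ContinuousAt (fun p : ℝ => (p : ℂ)⁻¹) 1 :=
    Complex.continuous_ofReal.continuousAt.inv₀ (by simp)
  have h₂ := (hc.tendsto.mono_left (nhdsWithin_le_nhds (s := Set.Ioo (0 : ℝ) 1))).smul h₁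
  simp only [Complex.ofReal_one, inv_one, sub_zero, one_smul] at h₂
  refine h₂.congr' ?_
  filter_upwards [self_mem_nhdsWithin] with p hp
  rw [← sub_smul_apply_invOneSub hT hq hp hb hy, sub_sub_cancel,
    inv_smul_smul₀ (by exact_mod_cast hp.1.ne')]

lemma tendsto_sub_smul_apply_invOneSub (hT : ‖T‖ ≤ 1)
    (hinj : Function.Injective fun x : H => ((1 : H →L[ℂ] H) - T) x)
    {q : ℝ} (hq : q ∈ Set.Ioo (0 : ℝ) 1) {a b c : H →L[ℂ] H} {κ d : ℂ}
    (ha : ∀ x, a (T x) = T (a x) - κ • b (c x)) (hc : ∀ x, c (T x) = (q : ℂ) • T (c x))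
    {h y z : H} (hz : c h + z = (q : ℂ) • T z)
    (hy : a h + y = T y + d • h - κ • b z) :
    Tendsto (fun p : ℝ => a (-invOneSub T p h) - d • -invOneSub T p h)
      (𝓝[Set.Ioo (0 : ℝ) 1] 1) (𝓝 y) := by
  have h₁ := (tendsto_invOneSub_sub hT hinj y).add
    (tendsto_one_sub_smul_invOneSub hT hinj
      (((b.continuous.tendsto _).comp (tendsto_invOneSub_mul hT hq z)).const_smul κ))
  rw [add_zero] at h₁
  refine h₁.congr' ?_
  filter_upwards [self_mem_nhdsWithin] with p hp
  have hd := sub_smul_apply_invOneSub hT hq hp hc hz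
  set f := invOneSub T p h
  have hf : f - (p : ℂ) • T f = h := invOneSub_sub_apply hT hp h
  have hTf : T (a f) = a (T f) + κ • b (c f) := by rw [ha]; abel
  have hbz := congrArg b hd
  simp only [map_sub, map_smul, map_neg] at hbz
  have haf := congrArg a hf
  simp only [map_sub, map_smul] at haf
  rw [← invOneSub_apply_sub hT hp (a (-f) - d • -f), ← map_smul, ← map_add]
  congr 1
  simp only [Function.comp_apply, map_sub, map_smul, map_neg, hTf]
  linear_combination (norm := module) hy + haf - d • hf - κ • hbz

end Resolvent

/-- The entries of a matrix with `∑ s, (u s k)* (u s k) = 1` are represented by contractions. -/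
lemma norm_map_le_one_of_sum_star_mul {H : Type*} [NormedAddCommGroup H] [InnerProductSpace ℂ H]
    [CompleteSpace H] {A : Type*} [Ring A] [Algebra ℂ A] [StarRing A] {ι : Type*} [Fintype ι]
    (π : A →⋆ₐ[ℂ] (H →L[ℂ] H)) {v : ι → A} (hv : ∑ s, star (v s) * v s = 1) (s : ι) :
    ‖π (v s)‖ ≤ 1 := by
  refine ContinuousLinearMap.opNorm_le_bound _ zero_le_one fun x => ?_
  have hsum : ∑ t, ‖π (v t) x‖ ^ 2 = ‖x‖ ^ 2 := by
    have h := congrArg (fun a => inner ℂ x (π a x)) hv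
    simp only [map_sum, map_mul, map_star, map_one, sum_apply,
      mul_apply_eq_comp, one_apply_eq_self, inner_sum,
      ContinuousLinearMap.star_eq_adjoint, ContinuousLinearMap.adjoint_inner_right,
      inner_self_eq_norm_sq_to_K] at h
    exact_mod_cast h
  have hle := Finset.single_le_sum (f := fun t => ‖π (v t) x‖ ^ 2)
    (fun t _ => by positivity) (Finset.mem_univ s)
  rw [hsum] at hle
  rw [one_mul]
  exact le_of_sq_le_sq hle (norm_nonneg x)

/-- Pointwise convergence of coboundaries to a cocycle can be tested on algebra generators. -/
lemma tendsto_coboundary_of_adjoin_eq_top {H : Type*} [NormedAddCommGroup H] [NormedSpace ℂ H]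
    {A : Type*} [Ring A] [Algebra ℂ A] (ε : A →ₐ[ℂ] ℂ) (π : A →ₐ[ℂ] (H →L[ℂ] H))
    (η : A →ₗ[ℂ] H) (hη : ∀ a b : A, η (a * b) = π a (η b) + ε b • η a)
    {S : Set A} (hS : Algebra.adjoin ℂ S = ⊤) {X : Type*} {l : Filter X} {f : X → H}
    (h : ∀ a ∈ S, Tendsto (fun p => π a (f p) - ε a • f p) l (𝓝 (η a))) (a : A) :
    Tendsto (fun p => π a (f p) - ε a • f p) l (𝓝 (η a)) := by
  have h1 : η 1 = 0 := by simpa using hη 1 1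
  have ha : a ∈ Algebra.adjoin ℂ S := hS ▸ Algebra.mem_top
  induction ha using Algebra.adjoin_induction with
  | mem a ha => exact h a ha
  | algebraMap r => simp [Algebra.algebraMap_eq_smul_one, h1, tendsto_const_nhds]
  | add a b _ _ iha ihb =>
    rw [map_add η]
    refine (iha.add ihb).congr fun p => ?_
    simp only [map_add, add_apply]
    module
  | mul a b _ _ iha ihb =>
    rw [hη]
    refine ((((π a).continuous.tendsto _).comp ihb).add (iha.const_smul (ε b))).congr fun p => ?_
    simp only [Function.comp_apply, map_mul, mul_apply_eq_comp, map_sub, map_smul]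
    module

/-- Approximation of cocycles by coboundaries: if `1 - π(u_{NN})` is injective, then for every
`a`, `π(a - ε(a)·1) f_p → η(a)` as `p ↑ 1`, where `f_p := -(1 - p·π(u_{NN}))⁻¹ η(u_{NN})`.
Here `u i j` corresponds to `u_{i+1,j+1}` of the paper and `nn` to the index `N`. -/
theorem stmt_6 {H : Type*} [NormedAddCommGroup H] [InnerProductSpace ℂ H] [CompleteSpace H]
    {A : Type*} [Ring A] [Algebra ℂ A] [StarRing A] [StarModule ℂ A]
    (q : ℝ) (hq0 : 0 < q) (hq1 : q < 1) (N : ℕ) (hN : 2 ≤ N)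
    (u : Fin N → Fin N → A)
    (rel1 : ∀ i k j : Fin N, i < k → u i j * u k j = (q : ℂ) • (u k j * u i j))
    (rel2 : ∀ i j l : Fin N, j < l → u i j * u i l = (q : ℂ) • (u i l * u i j))
    (rel3 : ∀ i k j l : Fin N, i < k → l < j → u i j * u k l = u k l * u i j)
    (rel4 : ∀ i k j l : Fin N, i < k → j < l →
      u i j * u k l = u k l * u i j - ((q : ℂ)⁻¹ - (q : ℂ)) • (u i l * u k j))
    (unit1 : ∀ j k : Fin N, (∑ s : Fin N, u j s * star (u k s)) = if j = k then (1 : A) else 0)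
    (unit2 : ∀ j k : Fin N, (∑ s : Fin N, star (u s j) * u s k) = if j = k then (1 : A) else 0)
    (mix1 : ∀ i k j l : Fin N, i ≠ k → j ≠ l → u i j * star (u k l) = star (u k l) * u i j)
    (mix2 : ∀ i k j : Fin N, i ≠ k →
      u i j * star (u k j) = (q : ℂ) • (star (u k j) * u i j) -
        (1 - (q : ℂ) ^ 2) • ∑ p ∈ Finset.univ.filter (fun p : Fin N => p < j), u i p * star (u k p))
    (mix3 : ∀ i j l : Fin N, j ≠ l →
      u i j * star (u i l) = (q : ℂ)⁻¹ • (star (u i l) * u i j) +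
        ((q : ℂ)⁻¹ - (q : ℂ)) • ∑ s ∈ Finset.univ.filter (fun s : Fin N => i < s), star (u s l) * u s j)
    (mix4 : ∀ i j : Fin N,
      u i j * star (u i j) = star (u i j) * u i j +
        (1 - (q : ℂ) ^ 2) • ∑ s ∈ Finset.univ.filter (fun s : Fin N => i < s), star (u s j) * u s j -
        (1 - (q : ℂ) ^ 2) • ∑ p ∈ Finset.univ.filter (fun p : Fin N => p < j), u i p * star (u i p))
    (ε : A →⋆ₐ[ℂ] ℂ) (hε : ∀ j k : Fin N, ε (u j k) = if j = k then 1 else 0)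
    (π : A →⋆ₐ[ℂ] (H →L[ℂ] H))
    (nn : Fin N) (hnn : (nn : ℕ) = N - 1)
    (hinj : Function.Injective fun x : H => ((1 : H →L[ℂ] H) - π (u nn nn)) x)
    (η : A →ₗ[ℂ] H) (hη : ∀ a b : A, η (a * b) = π a (η b) + ε b • η a)
    (hgen : Algebra.adjoin ℂ {a : A | ∃ j k : Fin N, a = u j k} = ⊤) :
    ∀ a : A,
      Filter.Tendsto
        (fun p : ℝ =>
          π (a - ε a • 1)
            (-(Ring.inverse ((1 : H →L[ℂ] H) - (p : ℂ) • π (u nn nn)) (η (u nn nn)))))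
        (nhdsWithin 1 (Set.Ioo (0 : ℝ) 1)) (nhds (η a)) := by
  have hq : q ∈ Set.Ioo (0 : ℝ) 1 := ⟨hq0, hq1⟩
  have hT : ‖π (u nn nn)‖ ≤ 1 :=
    norm_map_le_one_of_sum_star_mul π (v := fun s => u s nn) (by simpa using unit2 nn nn) nn
  have hlt : ∀ j : Fin N, j ≠ nn → j < nn := fun j hj => by
    have := j.isLt
    have := Fin.val_ne_of_ne hj
    exact Fin.lt_def.mpr (by omega)
  have qcomm : ∀ b : A, b * u nn nn = (q : ℂ) • (u nn nn * b) → ε b = 0 →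
      (∀ x, π b (π (u nn nn) x) = (q : ℂ) • π (u nn nn) (π b x)) ∧
        π b (η (u nn nn)) + η b = (q : ℂ) • π (u nn nn) (η b) := fun b hb hεb => by
    refine ⟨fun x => ?_, ?_⟩
    · simpa [-Complex.coe_smul] using congrArg (fun a => π a x) hb
    · simpa [hη, hε, hεb] using congrArg η hb
  have row : ∀ k, k ≠ nn → _ := fun k hk =>
    qcomm (u nn k) (rel2 nn k nn (hlt k hk)) (by simp [hε, hk.symm])
  have col : ∀ j, j ≠ nn → _ := fun j hj =>
    qcomm (u j nn) (rel1 j nn nn (hlt j hj)) (by simp [hε, hj])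
  have key : ∀ a ∈ {a : A | ∃ j k : Fin N, a = u j k},
      Tendsto (fun p : ℝ => π a (-invOneSub (π (u nn nn)) p (η (u nn nn))) -
        ε a • -invOneSub (π (u nn nn)) p (η (u nn nn))) (𝓝[Set.Ioo (0 : ℝ) 1] 1)
        (𝓝 (η a)) := by
    rintro _ ⟨j, k, rfl⟩
    by_cases hj : j = nn <;> by_cases hk : k = nn
    · subst hj hk
      have := tendsto_sub_smul_apply_invOneSub hT hinj hq (a := π (u k k)) (b := 0) (c := 0)
        (κ := 0) (d := 1) (h := η (u k k)) (y := η (u k k)) (z := 0)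
        (by simp) (by simp) (by simp) (by simp)
      simpa [hε] using this
    · subst hj
      simpa [hε, Ne.symm hk] using tendsto_apply_invOneSub hT hq (row k hk).1 (row k hk).2
    · subst hk
      simpa [hε, hj] using tendsto_apply_invOneSub hT hq (col j hj).1 (col j hj).2
    · have hr := rel4 j nn k nn (hlt j hj) (hlt k hk)
      refine tendsto_sub_smul_apply_invOneSub hT hinj hq (b := π (u j nn)) (c := π (u nn k))
        (κ := (q : ℂ)⁻¹ - q) (fun x => ?_) (row k hk).1 (row k hk).2 ?_
      · simpa using congrArg (fun a => π a x) hr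
      · have hεk : ε (u nn k) = 0 := by simp [hε, Ne.symm hk]
        have hεn : ε (u nn nn) = 1 := by simp [hε]
        have h := congrArg η hr
        rw [map_sub, map_smul, hη, hη, hη, hεk, hεn, one_smul, zero_smul, add_zero] at h
        exact h
  intro a
  refine (tendsto_coboundary_of_adjoin_eq_top ε.toAlgHom π.toAlgHom η hη hgen key a).congr
    fun p => ?_
  simp [invOneSub]
end

section
/- Let π be a unital $*$-homomorphism from A into the bounded operators B(H) on a complex Hilbert space H such that 1 − π(u_{NN}) is injective. If η and η′ are two π-ε-cocycles with η(u_{NN}) = η′(u_{NN}), then η(u_{jk}) = η′(u_{jk}) for all 1 ≤ j,k ≤ N, and consequently η and η′ agree on the unital subalgebra of A generated by the elements u_{jk}. -/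
/-- If `∑ s, star (v s) * v s = 1` for a finite family in a `*`-algebra, then every `*`-representation
on a Hilbert space maps each `v s` to a contraction. -/
lemma norm_map_apply_le_of_sum_star_mul_self_eq_one {H A ι : Type*} [NormedAddCommGroup H]
    [InnerProductSpace ℂ H] [CompleteSpace H] [Ring A] [Algebra ℂ A] [StarRing A] [Fintype ι]
    (π : A →⋆ₐ[ℂ] (H →L[ℂ] H)) (v : ι → A) (hv : ∑ s, star (v s) * v s = 1) (i : ι) (x : H) :
    ‖π (v i) x‖ ≤ ‖x‖ := by
  have hsum : ∑ s, ‖π (v s) x‖ ^ 2 = ‖x‖ ^ 2 := by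
    have h := congrArg (fun a => RCLike.re (inner ℂ (π a x) x)) hv
    simpa [map_star, ContinuousLinearMap.star_eq_adjoint, sum_apply,
      sum_inner, ContinuousLinearMap.adjoint_inner_left, inner_self_eq_norm_sq_to_K,
      ← Complex.ofReal_pow] using h
  have hle : ‖π (v i) x‖ ^ 2 ≤ ∑ s, ‖π (v s) x‖ ^ 2 :=
    Finset.single_le_sum (f := fun s => ‖π (v s) x‖ ^ 2) (fun s _ => sq_nonneg _)
      (Finset.mem_univ i)
  exact le_of_sq_le_sq (hle.trans hsum.le) (norm_nonneg x)

/-- A linear map satisfying the cocycle identity for `π` and `ε` that vanishes on a set vanishes on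
the unital subalgebra generated by it. -/
lemma cocycle_eq_zero_of_mem_adjoin {H A : Type*} [NormedAddCommGroup H]
    [InnerProductSpace ℂ H] [CompleteSpace H] [Ring A] [Algebra ℂ A] [StarRing A]
    (ε : A →⋆ₐ[ℂ] ℂ) (π : A →⋆ₐ[ℂ] (H →L[ℂ] H)) (δ : A →ₗ[ℂ] H)
    (hδ : ∀ a b : A, δ (a * b) = π a (δ b) + ε b • δ a) {S : Set A} (hS : ∀ a ∈ S, δ a = 0)
    {a : A} (ha : a ∈ Algebra.adjoin ℂ S) : δ a = 0 := by
  have hone : δ 1 = 0 := by simpa using hδ 1 1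
  induction ha using Algebra.adjoin_induction with
  | mem a ha => exact hS a ha
  | algebraMap r => rw [Algebra.algebraMap_eq_smul_one, map_smul, hone, smul_zero]
  | add a b _ _ ha hb => rw [map_add, ha, hb, add_zero]
  | mul a b _ _ ha hb => rw [hδ, ha, hb, map_zero, smul_zero, add_zero]

/-- If `1 - π(u_{NN})` is injective, two `π`-`ε`-cocycles with the same value at `u_{NN}`
agree on all generators `u_{jk}` and hence on the unital subalgebra they generate.
Here `u i j` corresponds to `u_{i+1,j+1}` of the paper and `nn` to the index `N`. -/
theorem stmt_7 {H : Type*} [NormedAddCommGroup H] [InnerProductSpace ℂ H] [CompleteSpace H]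
    {A : Type*} [Ring A] [Algebra ℂ A] [StarRing A] [StarModule ℂ A]
    (q : ℝ) (hq0 : 0 < q) (hq1 : q < 1) (N : ℕ) (hN : 2 ≤ N)
    (u : Fin N → Fin N → A)
    (rel1 : ∀ i k j : Fin N, i < k → u i j * u k j = (q : ℂ) • (u k j * u i j))
    (rel2 : ∀ i j l : Fin N, j < l → u i j * u i l = (q : ℂ) • (u i l * u i j))
    (rel3 : ∀ i k j l : Fin N, i < k → l < j → u i j * u k l = u k l * u i j)
    (rel4 : ∀ i k j l : Fin N, i < k → j < l →
      u i j * u k l = u k l * u i j - ((q : ℂ)⁻¹ - (q : ℂ)) • (u i l * u k j))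
    (unit1 : ∀ j k : Fin N, (∑ s : Fin N, u j s * star (u k s)) = if j = k then (1 : A) else 0)
    (unit2 : ∀ j k : Fin N, (∑ s : Fin N, star (u s j) * u s k) = if j = k then (1 : A) else 0)
    (mix1 : ∀ i k j l : Fin N, i ≠ k → j ≠ l → u i j * star (u k l) = star (u k l) * u i j)
    (mix2 : ∀ i k j : Fin N, i ≠ k →
      u i j * star (u k j) = (q : ℂ) • (star (u k j) * u i j) -
        (1 - (q : ℂ) ^ 2) • ∑ p ∈ Finset.univ.filter (fun p : Fin N => p < j), u i p * star (u k p))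
    (mix3 : ∀ i j l : Fin N, j ≠ l →
      u i j * star (u i l) = (q : ℂ)⁻¹ • (star (u i l) * u i j) +
        ((q : ℂ)⁻¹ - (q : ℂ)) • ∑ s ∈ Finset.univ.filter (fun s : Fin N => i < s), star (u s l) * u s j)
    (mix4 : ∀ i j : Fin N,
      u i j * star (u i j) = star (u i j) * u i j +
        (1 - (q : ℂ) ^ 2) • ∑ s ∈ Finset.univ.filter (fun s : Fin N => i < s), star (u s j) * u s j -
        (1 - (q : ℂ) ^ 2) • ∑ p ∈ Finset.univ.filter (fun p : Fin N => p < j), u i p * star (u i p))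
    (ε : A →⋆ₐ[ℂ] ℂ) (hε : ∀ j k : Fin N, ε (u j k) = if j = k then 1 else 0)
    (π : A →⋆ₐ[ℂ] (H →L[ℂ] H))
    (nn : Fin N) (hnn : (nn : ℕ) = N - 1)
    (hinj : Function.Injective fun x : H => ((1 : H →L[ℂ] H) - π (u nn nn)) x)
    (η η' : A →ₗ[ℂ] H)
    (hη : ∀ a b : A, η (a * b) = π a (η b) + ε b • η a)
    (hη' : ∀ a b : A, η' (a * b) = π a (η' b) + ε b • η' a)
    (heq : η (u nn nn) = η' (u nn nn)) :
    (∀ j k : Fin N, η (u j k) = η' (u j k)) ∧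
    (∀ a ∈ Algebra.adjoin ℂ {a : A | ∃ j k : Fin N, a = u j k}, η a = η' a) := by
  have hδ : ∀ a b : A, (η - η') (a * b) = π a ((η - η') b) + ε b • (η - η') a := by
    intro a b
    simp only [LinearMap.sub_apply, hη, hη', map_sub, smul_sub]
    abel
  have hδnn : (η - η') (u nn nn) = 0 := sub_eq_zero.2 heq
  suffices hgen : ∀ j k : Fin N, (η - η') (u j k) = 0 by
    refine ⟨fun j k => sub_eq_zero.1 (hgen j k), fun a ha => sub_eq_zero.1 ?_⟩
    refine cocycle_eq_zero_of_mem_adjoin ε π (η - η') hδ ?_ ha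
    rintro _ ⟨j, k, rfl⟩
    exact hgen j k
  generalize η - η' = δ at hδ hδnn ⊢
  have hlt : ∀ j : Fin N, j ≠ nn → j < nn := by
    intro j hj
    have := j.isLt
    have := Fin.val_ne_of_ne hj
    rw [Fin.lt_def]
    omega
  have hfix : ∀ x : H, x = (q : ℂ) • π (u nn nn) x → x = 0 := by
    intro x hx
    have hle := norm_map_apply_le_of_sum_star_mul_self_eq_one π (fun s => u s nn)
      (by simpa using unit2 nn nn) nn x
    have hnorm : ‖x‖ = q * ‖π (u nn nn) x‖ := by
      conv_lhs => rw [hx]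
      rw [norm_smul, Complex.norm_real, Real.norm_of_nonneg hq0.le]
    rw [← norm_eq_zero]
    nlinarith [norm_nonneg x]
  have hcol : ∀ j : Fin N, j ≠ nn → δ (u j nn) = 0 := by
    intro j hj
    apply hfix
    have h := congrArg δ (rel1 j nn nn (hlt j hj))
    simpa [hδ, hδnn, hε, hj] using h
  have hrow : ∀ k : Fin N, k ≠ nn → δ (u nn k) = 0 := by
    intro k hk
    apply hfix
    have h := congrArg δ (rel2 nn k nn (hlt k hk))
    simpa [hδ, hδnn, hε, hk] using h
  intro j k
  by_cases hj : j = nn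
  · by_cases hk : k = nn
    · rw [hj, hk, hδnn]
    · rw [hj, hrow k hk]
  by_cases hk : k = nn
  · rw [hk, hcol j hj]
  have h := congrArg δ (rel4 j nn k nn (hlt j hj) (hlt k hk))
  have h' : δ (u j k) = π (u nn nn) (δ (u j k)) := by
    simpa [hδ, hδnn, hε, hcol j hj, hrow k hk] using h
  apply hinj
  simp [← h']
end

section
/- Let π be a unital $*$-homomorphism from A into the bounded operators B(H) on a complex Hilbert space H and let η: A → H be a π-ε-cocycle. Then for all j, k < N: η(u_{jN}) = −(1 − q·π(u_{NN}))^{-1} π(u_{jN}) η(u_{NN}); η(u_{Nk}) = −(1 − q·π(u_{NN}))^{-1} π(u_{Nk}) η(u_{NN}); and π(u_{NN} − 1) η(u_{jk}) = ( π(u_{jk} − δ_{jk}·1) − (q^{-1} − q)·(1 − q²·π(u_{NN}))^{-1} π(u_{jN} u_{Nk}) ) η(u_{NN}). -/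
open ContinuousLinearMap in
/-- If `∑ s, (a s)⋆ a s = 1`, then each `a s` is represented by a contraction. -/
theorem norm_starAlgHom_le_one_of_sum_star_mul_self {ι H A : Type*} [Fintype ι]
    [NormedAddCommGroup H] [InnerProductSpace ℂ H] [CompleteSpace H]
    [Ring A] [Algebra ℂ A] [StarRing A] (π : A →⋆ₐ[ℂ] (H →L[ℂ] H)) (a : ι → A)
    (ha : ∑ s, star (a s) * a s = 1) (s : ι) : ‖π (a s)‖ ≤ 1 := by
  refine opNorm_le_bound _ zero_le_one fun x => ?_
  have hsum : ∑ t, ‖π (a t) x‖ ^ 2 = ‖x‖ ^ 2 := by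
    have h := congrArg (fun T : H →L[ℂ] H => RCLike.re (inner ℂ (T x) x)) (congrArg π ha)
    simpa [map_sum, map_mul, map_star, sum_inner, star_eq_adjoint, adjoint_inner_left,
      ← Complex.ofReal_pow] using h
  rw [one_mul]
  refine (sq_le_sq₀ (norm_nonneg _) (norm_nonneg _)).mp ?_
  rw [← hsum]
  exact Finset.single_le_sum (f := fun t => ‖π (a t) x‖ ^ 2) (fun t _ => sq_nonneg _)
    (Finset.mem_univ s)

/-- `1 - c T` is invertible for a contraction `T` and `‖c‖ < 1`. -/
theorem isUnit_one_sub_smul_of_norm_le_one {H : Type*} [NormedAddCommGroup H]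
    [NormedSpace ℂ H] [CompleteSpace H] {T : H →L[ℂ] H} (hT : ‖T‖ ≤ 1) {c : ℂ}
    (hc : ‖c‖ < 1) : IsUnit (1 - c • T) := by
  refine isUnit_one_sub_of_norm_lt_one ?_
  rw [norm_smul]
  exact (mul_le_of_le_one_right (norm_nonneg c) hT).trans_lt hc

theorem ContinuousLinearMap.eq_inverse_apply {H : Type*} [NormedAddCommGroup H]
    [NormedSpace ℂ H] {T : H →L[ℂ] H} (hT : IsUnit T) {x y : H} (h : T x = y) :
    x = Ring.inverse T y := by
  rw [← h, ← mul_apply_eq_comp, Ring.inverse_mul_cancel _ hT,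
    one_apply_eq_self]

/-- A cocycle relation coming from a `q`-commutation `a b = q b a` with `ε a = 0`, `ε b = 1`. -/
theorem cocycle_eq_of_qCommute {H A : Type*} [NormedAddCommGroup H] [InnerProductSpace ℂ H]
    [CompleteSpace H] [Ring A] [Algebra ℂ A] [StarRing A] {ε : A →⋆ₐ[ℂ] ℂ}
    {π : A →⋆ₐ[ℂ] (H →L[ℂ] H)} {η : A →ₗ[ℂ] H}
    (hη : ∀ a b : A, η (a * b) = π a (η b) + ε b • η a) {c : ℂ} {a b : A}
    (hab : a * b = c • (b * a)) (ha : ε a = 0) (hb : ε b = 1)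
    (hu : IsUnit (1 - c • π b)) :
    η a = -(Ring.inverse (1 - c • π b) (π a (η b))) := by
  rw [← map_neg]
  refine ContinuousLinearMap.eq_inverse_apply hu ?_
  have h := congrArg η hab
  rw [map_smul, hη, hη, ha, hb, one_smul, zero_smul, add_zero] at h
  simp only [sub_apply, one_apply_eq_self,
    smul_apply, ← h]
  abel


/-- Cocycle relations on `Pol(SU_q(N))`: the values `η(u_{jN})`, `η(u_{Nk})` and
`π(u_{NN} - 1) η(u_{jk})` (`j, k < N`) are expressed in terms of `η(u_{NN})`.
Here `u i j` corresponds to `u_{i+1,j+1}` of the paper and `nn` to the index `N`. -/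
theorem stmt_8 {H : Type*} [NormedAddCommGroup H] [InnerProductSpace ℂ H] [CompleteSpace H]
    {A : Type*} [Ring A] [Algebra ℂ A] [StarRing A] [StarModule ℂ A]
    (q : ℝ) (hq0 : 0 < q) (hq1 : q < 1) (N : ℕ) (hN : 2 ≤ N)
    (u : Fin N → Fin N → A)
    (rel1 : ∀ i k j : Fin N, i < k → u i j * u k j = (q : ℂ) • (u k j * u i j))
    (rel2 : ∀ i j l : Fin N, j < l → u i j * u i l = (q : ℂ) • (u i l * u i j))
    (rel3 : ∀ i k j l : Fin N, i < k → l < j → u i j * u k l = u k l * u i j)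
    (rel4 : ∀ i k j l : Fin N, i < k → j < l →
      u i j * u k l = u k l * u i j - ((q : ℂ)⁻¹ - (q : ℂ)) • (u i l * u k j))
    (unit1 : ∀ j k : Fin N, (∑ s : Fin N, u j s * star (u k s)) = if j = k then (1 : A) else 0)
    (unit2 : ∀ j k : Fin N, (∑ s : Fin N, star (u s j) * u s k) = if j = k then (1 : A) else 0)
    (ε : A →⋆ₐ[ℂ] ℂ) (hε : ∀ j k : Fin N, ε (u j k) = if j = k then 1 else 0)
    (π : A →⋆ₐ[ℂ] (H →L[ℂ] H))
    (η : A →ₗ[ℂ] H) (hη : ∀ a b : A, η (a * b) = π a (η b) + ε b • η a)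
    (nn : Fin N) (hnn : (nn : ℕ) = N - 1) :
    ∀ j k : Fin N, j < nn → k < nn →
      η (u j nn) =
        -(Ring.inverse ((1 : H →L[ℂ] H) - (q : ℂ) • π (u nn nn))
            (π (u j nn) (η (u nn nn)))) ∧
      η (u nn k) =
        -(Ring.inverse ((1 : H →L[ℂ] H) - (q : ℂ) • π (u nn nn))
            (π (u nn k) (η (u nn nn)))) ∧
      π (u nn nn - 1) (η (u j k)) =
        ((π (u j k - if j = k then 1 else 0)) -
          ((q : ℂ)⁻¹ - (q : ℂ)) •
            (Ring.inverse ((1 : H →L[ℂ] H) - (q : ℂ) ^ 2 • π (u nn nn)) *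
              π (u j nn * u nn k)))
          (η (u nn nn)) := by
  intro j k hj hk
  have hT : ‖π (u nn nn)‖ ≤ 1 :=
    norm_starAlgHom_le_one_of_sum_star_mul_self π (fun s => u s nn) (by simp [unit2]) nn
  have hqn : ‖(q : ℂ)‖ < 1 := by simpa [abs_of_pos hq0] using hq1
  have hu1 := isUnit_one_sub_smul_of_norm_le_one hT hqn
  have hu2 := isUnit_one_sub_smul_of_norm_le_one hT (c := (q : ℂ) ^ 2)
    (by rw [norm_pow]; exact pow_lt_one₀ (norm_nonneg _) hqn two_ne_zero)
  have hεn : ε (u nn nn) = 1 := by simp [hε]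
  have hεk : ε (u nn k) = 0 := by simp [hε, hk.ne']
  have hηk := cocycle_eq_of_qCommute hη (rel2 nn k nn hk) hεk hεn hu1
  refine ⟨cocycle_eq_of_qCommute hη (rel1 j nn nn hj) (by simp [hε, hj.ne]) hεn hu1, hηk, ?_⟩
  have hcomm : π (u j nn) * (1 - (q : ℂ) • π (u nn nn)) =
      (1 - (q : ℂ) ^ 2 • π (u nn nn)) * π (u j nn) := by
    have h := congrArg π (rel1 j nn nn hj)
    rw [map_mul, map_smul, map_mul] at h
    rw [mul_sub, sub_mul, mul_smul_comm, h, smul_smul, smul_mul_assoc, mul_one, one_mul, sq]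
  have hinv : π (u j nn) * Ring.inverse (1 - (q : ℂ) • π (u nn nn)) =
      Ring.inverse (1 - (q : ℂ) ^ 2 • π (u nn nn)) * π (u j nn) := by
    rw [eq_comm, Ring.inverse_mul_eq_iff_eq_mul _ _ _ hu2, ← mul_assoc, ← hcomm,
      Ring.mul_inverse_cancel_right _ _ hu1]
  have h := congrArg η (rel4 j nn k nn hj hk)
  rw [map_sub, map_smul, hη, hη, hη, hεn, hεk, one_smul, zero_smul, add_zero, hηk, map_neg,
    ← mul_apply_eq_comp (π (u j nn)), hinv, hε] at h
  have hδ : π (if j = k then 1 else 0) (η (u nn nn)) =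
      (if j = k then (1 : ℂ) else 0) • η (u nn nn) := by
    split_ifs <;> simp
  simp only [map_sub, map_one, map_mul, sub_apply,
    one_apply_eq_self, smul_apply,
    mul_apply_eq_comp, hδ] at h ⊢
  rw [smul_neg, sub_neg_eq_add] at h
  linear_combination (norm := module) -h
end

section
/- Let 1 ≤ n < N and let π be a unital $*$-homomorphism from A into the bounded operators B(H) on a complex Hilbert space H such that π(u_{jk}) = δ_{jk}·id whenever max(j,k) > n, and such that 1 − π(u_{nn}) is injective. Then every π-ε-cocycle η: A → H satisfies η(u_{jk}) = 0 whenever max(j,k) > n. -/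
/-- If `π` lives on `SU_q(n)` (i.e. `π(u_{jk}) = δ_{jk}·id` for `max(j,k) > n`) and
`1 - π(u_{nn})` is injective, then every `π`-`ε`-cocycle vanishes on all `u_{jk}` with
`max(j,k) > n`. Here `u i j` corresponds to `u_{i+1,j+1}` of the paper and the index
`m : Fin N` with `(m : ℕ) < N - 1` corresponds to `n` with `1 ≤ n < N`. -/
theorem stmt_9 {H : Type*} [NormedAddCommGroup H] [InnerProductSpace ℂ H] [CompleteSpace H]
    {A : Type*} [Ring A] [Algebra ℂ A] [StarRing A] [StarModule ℂ A]
    (q : ℝ) (hq0 : 0 < q) (hq1 : q < 1) (N : ℕ) (hN : 2 ≤ N)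
    (u : Fin N → Fin N → A)
    (rel1 : ∀ i k j : Fin N, i < k → u i j * u k j = (q : ℂ) • (u k j * u i j))
    (rel2 : ∀ i j l : Fin N, j < l → u i j * u i l = (q : ℂ) • (u i l * u i j))
    (rel3 : ∀ i k j l : Fin N, i < k → l < j → u i j * u k l = u k l * u i j)
    (rel4 : ∀ i k j l : Fin N, i < k → j < l →
      u i j * u k l = u k l * u i j - ((q : ℂ)⁻¹ - (q : ℂ)) • (u i l * u k j))
    (unit1 : ∀ j k : Fin N, (∑ s : Fin N, u j s * star (u k s)) = if j = k then (1 : A) else 0)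
    (unit2 : ∀ j k : Fin N, (∑ s : Fin N, star (u s j) * u s k) = if j = k then (1 : A) else 0)
    (ε : A →⋆ₐ[ℂ] ℂ) (hε : ∀ j k : Fin N, ε (u j k) = if j = k then 1 else 0)
    (π : A →⋆ₐ[ℂ] (H →L[ℂ] H))
    (m : Fin N) (hm : (m : ℕ) < N - 1)
    (hlive : ∀ j k : Fin N, m < max j k → π (u j k) = if j = k then 1 else 0)
    (hinj : Function.Injective fun x : H => ((1 : H →L[ℂ] H) - π (u m m)) x)
    (η : A →ₗ[ℂ] H) (hη : ∀ a b : A, η (a * b) = π a (η b) + ε b • η a) :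
    ∀ j k : Fin N, m < max j k → η (u j k) = 0 := by
  have hq : (1 : ℂ) - (q : ℂ) ≠ 0 := by
    rw [sub_ne_zero]
    exact_mod_cast hq1.ne'
  have eq_zero_of_eq_smul : ∀ x : H, x = (q : ℂ) • x → x = 0 := by
    intro x hx
    have h : ((1 : ℂ) - (q : ℂ)) • x = 0 := by
      rw [sub_smul, one_smul, sub_eq_zero]
      exact hx
    exact (smul_eq_zero.mp h).resolve_left hq
  have row : ∀ j k : Fin N, m < k → j < k → η (u k j) = 0 := by
    intro j k hk hjk
    have h := congrArg η (rel2 k j k hjk)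
    simp only [map_smul, hη, hε, hlive k j (lt_max_of_lt_left hk),
      hlive k k (lt_max_of_lt_left hk), hjk.ne', if_true, if_false, one_smul, zero_smul,
      zero_apply, one_apply_eq_self, zero_add, add_zero] at h
    exact eq_zero_of_eq_smul _ h
  have col : ∀ j k : Fin N, m < k → j < k → η (u j k) = 0 := by
    intro j k hk hjk
    have h := congrArg η (rel1 j k k hjk)
    simp only [map_smul, hη, hε, hlive j k (lt_max_of_lt_right hk),
      hlive k k (lt_max_of_lt_left hk), hjk.ne, if_true, if_false, one_smul, zero_smul,
      zero_apply, one_apply_eq_self, zero_add, add_zero] at h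
    exact eq_zero_of_eq_smul _ h
  have diag : ∀ k : Fin N, m < k → η (u k k) = 0 := by
    intro k hk
    have h := congrArg η (rel4 m k m k hk hk)
    simp only [map_sub, map_smul, hη, hε, hlive m k (lt_max_of_lt_right hk),
      hlive k k (lt_max_of_lt_left hk), hk.ne, hk.ne', if_true, if_false, one_smul, zero_smul,
      zero_apply, one_apply_eq_self, add_zero,
      smul_zero, sub_zero] at h
    rw [add_comm] at h
    apply hinj
    simp only [sub_apply, one_apply_eq_self, map_zero]
    rw [sub_eq_zero]
    exact (add_left_cancel h).symm
  intro j k hjk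
  rcases lt_trichotomy j k with h | rfl | h
  · rw [max_eq_right h.le] at hjk
    exact col j k hjk h
  · exact diag j (by simpa using hjk)
  · rw [max_eq_left h.le] at hjk
    exact row k j hjk h
end

section
/- Assume in addition the quantum determinant relation Σ_{σ ∈ S_N} (−q)^{i(σ)}·u_{1,σ(1)} u_{2,σ(2)} ⋯ u_{N,σ(N)} = 1, where i(σ) is the number of inversions of the permutation σ. Put d_j := (u_{jj} − u_{jj}*)/(2i). Then: (a) for j ≠ k, u_{jk} ∈ K_n and u_{jk}* ∈ K_n for every n ≥ 1; (b) (u_{jj} − 1) + (u_{jj}* − 1) ∈ K₂ for every j; (c) d₁ + d₂ + ⋯ + d_N ∈ K₂; (d) d_j d_k − d_k d_j ∈ K_n for every n ≥ 1 (in particular d_j d_k − d_k d_j ∈ K₃). -/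
namespace Submodule

variable {R A : Type*} [CommRing R] [Ring A] [Algebra R A] {K : Submodule R A}

theorem mul_mem_pow_of_left (hK : ∀ a, ∀ x ∈ K, a * x ∈ K) {n : ℕ} (hn : 1 ≤ n) (a : A) {x : A}
    (hx : x ∈ K ^ n) : a * x ∈ K ^ n := by
  obtain ⟨m, rfl⟩ := Nat.exists_eq_add_of_le' hn
  have h : (⊤ : Submodule R A) * K ^ (m + 1) ≤ K ^ (m + 1) := by
    rw [pow_succ', ← mul_assoc]
    exact mul_le_mul_left (mul_le.2 fun a _ x hx => hK a x hx) _
  exact h (mul_mem_mul mem_top hx)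

theorem mul_mem_pow_of_right (hK : ∀ a, ∀ x ∈ K, x * a ∈ K) {n : ℕ} (hn : 1 ≤ n) (a : A) {x : A}
    (hx : x ∈ K ^ n) : x * a ∈ K ^ n := by
  obtain ⟨m, rfl⟩ := Nat.exists_eq_add_of_le' hn
  have h : K ^ (m + 1) * (⊤ : Submodule R A) ≤ K ^ (m + 1) := by
    rw [pow_succ, mul_assoc]
    exact mul_le_mul_right (mul_le.2 fun x hx a _ => hK a x hx) _
  exact h (mul_mem_mul hx mem_top)

/-- If `a ∈ K` and `b ∈ 1 + K` commute up to a scalar `q` with `1 - q` invertible, then `a` lies in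
every power of `K`. -/
theorem mem_pow_of_mul_eq_smul_mul {q : R} (hq : IsUnit (1 - q)) {a b : A} (ha : a ∈ K)
    (hb : b - 1 ∈ K) (h : a * b = q • (b * a) ∨ b * a = q • (a * b)) {n : ℕ} (hn : 1 ≤ n) :
    a ∈ K ^ n := by
  induction n, hn using Nat.le_induction with
  | base => simpa using ha
  | succ n hn ih =>
    have h₁ : a * (b - 1) ∈ K ^ (n + 1) := by
      rw [pow_succ]; exact mul_mem_mul ih hb
    have h₂ : (b - 1) * a ∈ K ^ (n + 1) := by
      rw [pow_succ']; exact mul_mem_mul hb ih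
    rw [← (K ^ (n + 1)).smul_mem_iff_of_isUnit hq]
    rcases h with h | h
    · have e : (1 - q) • a = q • ((b - 1) * a) - a * (b - 1) := by
        rw [sub_mul, mul_sub, h, smul_sub, sub_smul]; simp
      rw [e]
      exact sub_mem (smul_mem _ _ h₂) h₁
    · have e : (1 - q) • a = q • (a * (b - 1)) - (b - 1) * a := by
        rw [sub_mul, mul_sub, h, smul_sub, sub_smul]; simp
      rw [e]
      exact sub_mem (smul_mem _ _ h₁) h₂

theorem list_prod_mem_pow (hl : ∀ a, ∀ x ∈ K, a * x ∈ K) (hr : ∀ a, ∀ x ∈ K, x * a ∈ K)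
    {n : ℕ} (hn : 1 ≤ n) {l : List A} {x : A} (hx : x ∈ l) (hxK : x ∈ K ^ n) :
    l.prod ∈ K ^ n := by
  obtain ⟨s, t, rfl⟩ := List.append_of_mem hx
  rw [List.prod_append, List.prod_cons]
  exact mul_mem_pow_of_left hl hn _ (mul_mem_pow_of_right hr hn _ hxK)

/-- Modulo `K ^ 2`, a product of elements of `1 + K` is additive. -/
theorem list_prod_sub_one_sub_sum_mem (hr : ∀ a, ∀ x ∈ K, x * a ∈ K) {ι : Type*} (l : List ι)
    (f : ι → A) (hf : ∀ i, f i - 1 ∈ K) :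
    (l.map f).prod - 1 ∈ K ∧
      (l.map f).prod - 1 - (l.map fun i => f i - 1).sum ∈ K ^ 2 := by
  induction l with
  | nil => simp
  | cons i l ih =>
    simp only [List.map_cons, List.prod_cons, List.sum_cons]
    generalize (l.map f).prod = p at *
    generalize (l.map fun i => f i - 1).sum = s at *
    have e : f i * p - 1 - (f i - 1 + s) = (f i - 1) * (p - 1) + (p - 1 - s) := by noncomm_ring
    refine ⟨?_, ?_⟩
    · have e : f i * p - 1 = (f i - 1) * p + (p - 1) := by noncomm_ring
      rw [e]
      exact add_mem (hr _ _ (hf i)) ih.1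
    · rw [e, pow_two]
      exact add_mem (mul_mem_mul (hf i) ih.1) (pow_two K ▸ ih.2)

end Submodule

/-- Lemma on the kernel ideals of `Pol(SU_q(N))` (with the quantum determinant condition):
(a) off-diagonal generators and their adjoints lie in `K_n = K₁ⁿ` for every `n ≥ 1`;
(b) `(u_{jj} - 1) + (u_{jj}* - 1) ∈ K₂`; (c) `d₁ + ⋯ + d_N ∈ K₂` where
`d_j = (u_{jj} - u_{jj}*)/(2i)`; (d) `d_j d_k - d_k d_j ∈ K_n` for every `n ≥ 1`.
Here `u i j` corresponds to `u_{i+1,j+1}` of the paper. -/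
theorem stmt_11 {A : Type*} [Ring A] [Algebra ℂ A] [StarRing A] [StarModule ℂ A]
    (q : ℝ) (hq0 : 0 < q) (hq1 : q < 1) (N : ℕ) (hN : 2 ≤ N)
    (u : Fin N → Fin N → A)
    (rel1 : ∀ i k j : Fin N, i < k → u i j * u k j = (q : ℂ) • (u k j * u i j))
    (rel2 : ∀ i j l : Fin N, j < l → u i j * u i l = (q : ℂ) • (u i l * u i j))
    (rel3 : ∀ i k j l : Fin N, i < k → l < j → u i j * u k l = u k l * u i j)
    (rel4 : ∀ i k j l : Fin N, i < k → j < l →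
      u i j * u k l = u k l * u i j - ((q : ℂ)⁻¹ - (q : ℂ)) • (u i l * u k j))
    (unit1 : ∀ j k : Fin N, (∑ s : Fin N, u j s * star (u k s)) = if j = k then (1 : A) else 0)
    (unit2 : ∀ j k : Fin N, (∑ s : Fin N, star (u s j) * u s k) = if j = k then (1 : A) else 0)
    (mix1 : ∀ i k j l : Fin N, i ≠ k → j ≠ l → u i j * star (u k l) = star (u k l) * u i j)
    (hdet : (∑ σ : Equiv.Perm (Fin N),
        ((-(q : ℂ)) ^
            (Finset.univ.filter (fun p : Fin N × Fin N => p.1 < p.2 ∧ σ p.2 < σ p.1)).card) •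
          ((List.finRange N).map fun i => u i (σ i)).prod) = 1)
    (ε : A →⋆ₐ[ℂ] ℂ) (hε : ∀ j k : Fin N, ε (u j k) = if j = k then 1 else 0) :
    ∀ d : Fin N → A, (∀ j, d j = ((2 * Complex.I)⁻¹ : ℂ) • (u j j - star (u j j))) →
    ∀ K : Submodule ℂ A, K = LinearMap.ker ε.toAlgHom.toLinearMap →
      ((∀ j k : Fin N, j ≠ k → ∀ n : ℕ, 1 ≤ n → u j k ∈ K ^ n ∧ star (u j k) ∈ K ^ n) ∧
       (∀ j : Fin N, (u j j - 1) + (star (u j j) - 1) ∈ K ^ 2) ∧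
       (∑ j : Fin N, d j) ∈ K ^ 2 ∧
       (∀ j k : Fin N, ∀ n : ℕ, 1 ≤ n → d j * d k - d k * d j ∈ K ^ n)) := by
  intro d hd K hK
  have memK (x : A) : x ∈ K ↔ ε x = 0 := by subst hK; exact Iff.rfl
  have hl : ∀ a, ∀ x ∈ K, a * x ∈ K := fun a x hx => by
    rw [memK] at hx ⊢; rw [map_mul, hx, mul_zero]
  have hr : ∀ a, ∀ x ∈ K, x * a ∈ K := fun a x hx => by
    rw [memK] at hx ⊢; rw [map_mul, hx, zero_mul]
  have hq : IsUnit (1 - (q : ℂ)) := by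
    rw [isUnit_iff_ne_zero, sub_ne_zero]
    exact_mod_cast hq1.ne'
  have diag (j : Fin N) : u j j - 1 ∈ K := by simp [memK, hε]
  have diag_star (j : Fin N) : star (u j j) - 1 ∈ K := by simp [memK, map_star, hε]
  have rel1_star (i k j : Fin N) (h : i < k) :
      star (u k j) * star (u i j) = (q : ℂ) • (star (u i j) * star (u k j)) := by
    simpa using congrArg star (rel1 i k j h)
  have offdiag : ∀ j k : Fin N, j ≠ k → ∀ n : ℕ, 1 ≤ n →
      u j k ∈ K ^ n ∧ star (u j k) ∈ K ^ n := by
    intro j k hjk n hn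
    have hm : u j k ∈ K := by simp [memK, hε, hjk]
    have hm' : star (u j k) ∈ K := by simp [memK, map_star, hε, hjk]
    refine ⟨Submodule.mem_pow_of_mul_eq_smul_mul hq hm (diag k) ?_ hn,
      Submodule.mem_pow_of_mul_eq_smul_mul hq hm' (diag_star k) ?_ hn⟩
    · exact (lt_or_gt_of_ne hjk).imp (rel1 j k k) (rel1 k j k)
    · exact (lt_or_gt_of_ne hjk).symm.imp (rel1_star k j k) (rel1_star j k k)
  have hb (j : Fin N) : (u j j - 1) + (star (u j j) - 1) ∈ K ^ 2 := by
    have h := unit1 j j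
    rw [if_pos rfl, ← Finset.add_sum_erase _ _ (Finset.mem_univ j)] at h
    have e : (u j j - 1) + (star (u j j) - 1) =
        -(∑ s ∈ Finset.univ.erase j, u j s * star (u j s)) - (u j j - 1) * (star (u j j) - 1) := by
      rw [← eq_sub_iff_add_eq'] at h
      rw [h]
      noncomm_ring
    rw [e]
    refine sub_mem (neg_mem (sum_mem fun s hs => ?_)) ?_
    · exact Submodule.mul_mem_pow_of_right hr one_le_two _
        (offdiag j s (Finset.ne_of_mem_erase hs).symm 2 one_le_two).1
    · rw [pow_two]
      exact Submodule.mul_mem_mul (diag j) (diag_star j)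
  have htrace : ∑ j, (u j j - 1) ∈ K ^ 2 := by
    rw [← Finset.add_sum_erase _ _ (Finset.mem_univ (1 : Equiv.Perm (Fin N)))] at hdet
    have h₁ : (Finset.univ.filter (fun p : Fin N × Fin N => p.1 < p.2 ∧
        (1 : Equiv.Perm (Fin N)) p.2 < (1 : Equiv.Perm (Fin N)) p.1)).card = 0 := by
      rw [Finset.card_eq_zero, Finset.filter_eq_empty_iff]
      exact fun p _ hp => lt_asymm hp.1 hp.2
    rw [h₁, pow_zero, one_smul, ← eq_sub_iff_add_eq] at hdet
    have h₂ := (Submodule.list_prod_sub_one_sub_sum_mem hr (List.finRange N)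
      (fun i => u i i) diag).2
    simp only [Equiv.Perm.one_apply] at hdet
    rw [hdet, ← List.ofFn_eq_map, List.sum_ofFn, sub_sub_cancel_left, ← neg_add',
      Submodule.neg_mem_iff] at h₂
    refine (Submodule.add_mem_iff_right _ (sum_mem fun σ hσ => Submodule.smul_mem _ _ ?_)).1 h₂
    obtain ⟨i, hi⟩ : ∃ i, σ i ≠ i := by
      by_contra! h
      exact Finset.ne_of_mem_erase hσ (Equiv.ext h)
    exact Submodule.list_prod_mem_pow hl hr one_le_two
      (List.mem_map.2 ⟨i, List.mem_finRange i, rfl⟩) (offdiag i (σ i) hi.symm 2 one_le_two).1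
  refine ⟨offdiag, hb, ?_, ?_⟩
  · have e : ∑ j, d j = ((2 * Complex.I)⁻¹ : ℂ) • ((2 : ℂ) • ∑ j, (u j j - 1) -
        ∑ j, ((u j j - 1) + (star (u j j) - 1))) := by
      simp only [hd]
      rw [← Finset.smul_sum, Finset.smul_sum (r := (2 : ℂ)), ← Finset.sum_sub_distrib]
      congr 1
      refine Finset.sum_congr rfl fun j _ => ?_
      rw [two_smul]
      abel
    rw [e]
    exact Submodule.smul_mem _ _
      (sub_mem (Submodule.smul_mem _ _ htrace) (sum_mem fun j _ => hb j))
  · have key (j k : Fin N) (hjk : j < k) (n : ℕ) (hn : 1 ≤ n) : d j * d k - d k * d j ∈ K ^ n := by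
      have h₁ : u j j * u k k - u k k * u j j =
          -(((q : ℂ)⁻¹ - (q : ℂ)) • (u j k * u k j)) := by
        rw [rel4 j k j k hjk hjk]
        abel
      have h₂ : star (u j j) * star (u k k) - star (u k k) * star (u j j) =
          ((q : ℂ)⁻¹ - (q : ℂ)) • (star (u k j) * star (u j k)) := by
        have h := congrArg star h₁
        simp only [star_sub, star_mul, star_neg, star_smul, star_inv₀, Complex.star_def,
          Complex.conj_ofReal] at h
        rw [← neg_sub, h, neg_neg]
      have h₃ := mix1 j k j k hjk.ne hjk.ne
      have h₄ := mix1 k j k j hjk.ne' hjk.ne'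
      have e : d j * d k - d k * d j = ((2 * Complex.I)⁻¹ * (2 * Complex.I)⁻¹ : ℂ) •
          ((u j j * u k k - u k k * u j j) +
            (star (u j j) * star (u k k) - star (u k k) * star (u j j))) := by
        simp only [hd, smul_mul_smul_comm, ← smul_sub]
        congr 1
        simp only [sub_mul, mul_sub, h₃, h₄]
        abel
      rw [e, h₁, h₂]
      exact Submodule.smul_mem _ _ (add_mem
        (neg_mem (Submodule.smul_mem _ _
          (Submodule.mul_mem_pow_of_right hr hn _ (offdiag j k hjk.ne n hn).1)))
        (Submodule.smul_mem _ _
          (Submodule.mul_mem_pow_of_right hr hn _ (offdiag k j hjk.ne' n hn).2)))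
    intro j k n hn
    rcases lt_trichotomy j k with h | rfl | h
    · exact key j k h n hn
    · rw [sub_self]
      exact zero_mem _
    · rw [← neg_sub]
      exact neg_mem (key k j h n hn)
end
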